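/- arXiv:2604.18317 — 2 statements merged into one kernel-verified Lean document; each statement's English description precedes it below -/
import Mathlib

section
/- There exists a perfect strategy for the 3×3 quantum magic square game: there exist a positive integer d (one may take d = 4), complex d×d Hermitian unitary matrices A_{ij} and B_{ij} (1 ≤ i,j ≤ 3) with the A's commuting within each row and satisfying ∏_{j=1}^3 A_{ij} = I for each row i, the B's commuting within each column and satisfying ∏_{i=1}^3 B_{ij} = −I for each column j, and a unit vector ψ ∈ ℂ^{d}⊗ℂ^{d} such that ⟨ψ, (A_{ij} ⊗ B_{ij}) ψ⟩ = 1 for all i,j. -/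
open Matrix Kronecker

/-- An `m × n` quantum magic rectangle strategy: Alice's observables `A i j` are Hermitian
unitaries commuting within each row with each row product `I`; Bob's observables `B i j` are
Hermitian unitaries commuting within each column with each column product `-I`; `ψ` is a unit
vector in the (Kronecker) tensor product; and the strategy is perfect:
`⟨ψ, (A i j ⊗ B i j) ψ⟩ = 1` for all cells `(i, j)`. -/
def IsPerfectStrategy {m n : ℕ} {ιA ιB : Type*}
    [Fintype ιA] [DecidableEq ιA] [Fintype ιB] [DecidableEq ιB]
    (A : Fin m → Fin n → Matrix ιA ιA ℂ)
    (B : Fin m → Fin n → Matrix ιB ιB ℂ)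
    (ψ : ιA × ιB → ℂ) : Prop :=
  (∀ i j, (A i j).IsHermitian) ∧
  (∀ i j, A i j * A i j = 1) ∧
  (∀ i j j', A i j * A i j' = A i j' * A i j) ∧
  (∀ i, (List.ofFn fun j => A i j).prod = 1) ∧
  (∀ i j, (B i j).IsHermitian) ∧
  (∀ i j, B i j * B i j = 1) ∧
  (∀ i i' j, B i j * B i' j = B i' j * B i j) ∧
  (∀ j, (List.ofFn fun i => B i j).prod = -1) ∧
  star ψ ⬝ᵥ ψ = 1 ∧
  (∀ i j, star ψ ⬝ᵥ ((A i j ⊗ₖ B i j) *ᵥ ψ) = 1)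

/-- The maximally entangled state evaluates `A ⊗ B` to the normalized trace of `A * Bᵀ`. -/
theorem star_vec_one_dotProduct_kronecker_mulVec {ι : Type*} [Fintype ι] [DecidableEq ι]
    (c : ℂ) (A B : Matrix ι ι ℂ) :
    star (c • vec (1 : Matrix ι ι ℂ)) ⬝ᵥ ((A ⊗ₖ B) *ᵥ (c • vec (1 : Matrix ι ι ℂ))) =
      star c * c * (B * Aᵀ).trace := by
  rw [mulVec_smul, kronecker_mulVec_vec, star_smul, smul_dotProduct, dotProduct_smul,
    star_vec_dotProduct_vec]
  simp [mul_assoc]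

/-- The Kronecker product of two `2 × 2` integer matrices, as a `4 × 4` matrix. -/
def kroneckerTwo (a b : Matrix (Fin 2) (Fin 2) ℤ) : Matrix (Fin 4) (Fin 4) ℤ :=
  (a ⊗ₖ b).submatrix (finProdFinEquiv (m := 2) (n := 2)).symm
    (finProdFinEquiv (m := 2) (n := 2)).symm

/-- The Pauli matrix `X`. -/
def pauliX : Matrix (Fin 2) (Fin 2) ℤ := !![0, 1; 1, 0]

/-- The Pauli matrix `Z`. -/
def pauliZ : Matrix (Fin 2) (Fin 2) ℤ := !![1, 0; 0, -1]

/-- The Mermin–Peres magic square, with signs chosen so that every row multiplies to `1`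
and every column to `-1`. The last entry is `Y ⊗ Y`. -/
def merminPeresSquare : Fin 3 → Fin 3 → Matrix (Fin 4) (Fin 4) ℤ :=
  ![![-kroneckerTwo pauliX 1, -kroneckerTwo 1 pauliX, kroneckerTwo pauliX pauliX],
    ![kroneckerTwo 1 pauliZ, kroneckerTwo pauliZ 1, kroneckerTwo pauliZ pauliZ],
    ![kroneckerTwo pauliX pauliZ, kroneckerTwo pauliZ pauliX,
      -kroneckerTwo (pauliX * pauliZ) (pauliX * pauliZ)]]

theorem merminPeresSquare_transpose (i j : Fin 3) :
    (merminPeresSquare i j)ᵀ = merminPeresSquare i j := by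
  revert i j; decide +kernel

theorem merminPeresSquare_mul_self (i j : Fin 3) :
    merminPeresSquare i j * merminPeresSquare i j = 1 := by
  revert i j; decide +kernel

theorem merminPeresSquare_row_comm (i j j' : Fin 3) :
    merminPeresSquare i j * merminPeresSquare i j' =
      merminPeresSquare i j' * merminPeresSquare i j := by
  revert i j j'; decide +kernel

theorem merminPeresSquare_col_comm (i i' j : Fin 3) :
    merminPeresSquare i j * merminPeresSquare i' j =
      merminPeresSquare i' j * merminPeresSquare i j := by
  revert i i' j; decide +kernel

theorem merminPeresSquare_row_prod (i : Fin 3) :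
    (List.ofFn fun j => merminPeresSquare i j).prod = 1 := by
  revert i; decide +kernel

theorem merminPeresSquare_col_prod (j : Fin 3) :
    (List.ofFn fun i => merminPeresSquare i j).prod = -1 := by
  revert j; decide +kernel

/-- there exists a perfect strategy for the `3 × 3` quantum magic square game
(one may take local dimension `d = 4`). -/
theorem exists_perfect_strategy_magic_square :
    ∃ (d : ℕ) (_ : 0 < d)
      (A B : Fin 3 → Fin 3 → Matrix (Fin d) (Fin d) ℂ)
      (ψ : Fin d × Fin d → ℂ),
      IsPerfectStrategy A B ψ := by
  let f : Matrix (Fin 4) (Fin 4) ℤ →+* Matrix (Fin 4) (Fin 4) ℂ :=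
    (Int.castRingHom ℂ).mapMatrix
  let S : Fin 3 → Fin 3 → Matrix (Fin 4) (Fin 4) ℂ := fun i j => f (merminPeresSquare i j)
  have transpose_eq (i j) : (S i j)ᵀ = S i j :=
    congrArg f (merminPeresSquare_transpose i j)
  have isHermitian (i j) : (S i j).IsHermitian := by
    refine Eq.trans ?_ (transpose_eq i j)
    ext k l
    simp [S, f]
  have mul_self (i j) : S i j * S i j = 1 := by
    simp only [S, ← map_mul, merminPeresSquare_mul_self, map_one]
  refine ⟨4, by norm_num, S, S, (1 / 2 : ℂ) • vec 1, isHermitian, mul_self, ?_, ?_,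
    isHermitian, mul_self, ?_, ?_, ?_, ?_⟩
  · intro i j j'
    simp only [S, ← map_mul, merminPeresSquare_row_comm i j j']
  · intro i
    simpa [S, map_list_prod, List.map_ofFn, Function.comp_def] using
      congrArg f (merminPeresSquare_row_prod i)
  · intro i i' j
    simp only [S, ← map_mul, merminPeresSquare_col_comm i i' j]
  · intro j
    simpa [S, map_list_prod, List.map_ofFn, Function.comp_def] using
      congrArg f (merminPeresSquare_col_prod j)
  · have h := star_vec_one_dotProduct_kronecker_mulVec (1 / 2) (1 : Matrix (Fin 4) (Fin 4) ℂ) 1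
    rw [one_kronecker_one, one_mulVec] at h
    rw [h]
    norm_num [trace_one]
  · intro i j
    rw [star_vec_one_dotProduct_kronecker_mulVec, transpose_eq, mul_self]
    norm_num [trace_one]
end

section
/- Let (A¹_{ij}), (B¹_{ij}), ψ¹ and (A²_{ij}), (B²_{ij}), ψ² be perfect strategies for the m×n quantum magic rectangle game of local dimensions (d_A¹, d_B¹) and (d_A², d_B²) respectively, and let β₁, β₂ > 0 with β₁² + β₂² = 1. Define block-diagonal observables A_{ij} = A¹_{ij} ⊕ A²_{ij} on ℂ^{d_A¹+d_A²} and B_{ij} = B¹_{ij} ⊕ B²_{ij} on ℂ^{d_B¹+d_B²}, and let ψ be the image of β₁ψ¹ + β₂ψ² under the canonical isometric embedding of (ℂ^{d_A¹}⊗ℂ^{d_B¹}) ⊕ (ℂ^{d_A²}⊗ℂ^{d_B²}) into ℂ^{d_A¹+d_A²} ⊗ ℂ^{d_B¹+d_B²} (sending e_p⊗f_q of each block to the corresponding standard basis tensor). Then (A_{ij}), (B_{ij}), ψ is a perfect strategy for the m×n quantum magic rectangle game. -/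
open Matrix Kronecker

theorem prod_ofFn_fromBlocks_diagonal {R ι κ : Type*} [Semiring R]
    [Fintype ι] [DecidableEq ι] [Fintype κ] [DecidableEq κ] {n : ℕ}
    (M : Fin n → Matrix ι ι R) (N : Fin n → Matrix κ κ R) :
    (List.ofFn fun k => Matrix.fromBlocks (M k) 0 0 (N k)).prod =
      Matrix.fromBlocks (List.ofFn M).prod 0 0 (List.ofFn N).prod := by
  induction n with
  | zero => simp
  | succ n ih => simp [List.ofFn_succ, ih, Matrix.fromBlocks_multiply]

/-- The weighted sum of two bipartite states, supported on the two diagonal blocks. -/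
def directSumState {α₁ α₂ γ₁ γ₂ : Type*} (b₁ b₂ : ℝ) (φ₁ : α₁ × γ₁ → ℂ) (φ₂ : α₂ × γ₂ → ℂ) :
    (α₁ ⊕ α₂) × (γ₁ ⊕ γ₂) → ℂ := fun pq =>
  Sum.elim (fun p => Sum.elim (fun q => (b₁ : ℂ) * φ₁ (p, q)) 0 pq.2)
    (fun p => Sum.elim 0 (fun q => (b₂ : ℂ) * φ₂ (p, q)) pq.2) pq.1

section DirectSumState

variable {α₁ α₂ γ₁ γ₂ : Type*} [Fintype α₁] [Fintype α₂] [Fintype γ₁] [Fintype γ₂]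
  (b₁ b₂ : ℝ) (φ₁ χ₁ : α₁ × γ₁ → ℂ) (φ₂ χ₂ : α₂ × γ₂ → ℂ)

theorem kronecker_fromBlocks_mulVec_directSumState
    (M₁ : Matrix α₁ α₁ ℂ) (M₂ : Matrix α₂ α₂ ℂ) (N₁ : Matrix γ₁ γ₁ ℂ) (N₂ : Matrix γ₂ γ₂ ℂ) :
    (Matrix.fromBlocks M₁ 0 0 M₂ ⊗ₖ Matrix.fromBlocks N₁ 0 0 N₂) *ᵥ directSumState b₁ b₂ φ₁ φ₂ =
      directSumState b₁ b₂ ((M₁ ⊗ₖ N₁) *ᵥ φ₁) ((M₂ ⊗ₖ N₂) *ᵥ φ₂) := by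
  ext ⟨p | p, q | q⟩ <;>
    simp [directSumState, Matrix.mulVec, dotProduct, Fintype.sum_prod_type, Finset.mul_sum,
      mul_left_comm]

theorem star_directSumState_dotProduct :
    star (directSumState b₁ b₂ φ₁ φ₂) ⬝ᵥ directSumState b₁ b₂ χ₁ χ₂ =
      (b₁ : ℂ) ^ 2 * (star φ₁ ⬝ᵥ χ₁) + (b₂ : ℂ) ^ 2 * (star φ₂ ⬝ᵥ χ₂) := by
  simp only [directSumState, dotProduct, Fintype.sum_prod_type, Fintype.sum_sum_type,
    Finset.mul_sum, Pi.star_apply, Pi.zero_apply, Sum.elim_inl, Sum.elim_inr, map_mul, RCLike.star_def, Complex.conj_ofReal, map_zero,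
    mul_zero, Finset.sum_const_zero, add_zero, zero_add]
  congr 1 <;> refine Finset.sum_congr rfl fun _ _ => Finset.sum_congr rfl fun _ _ => ?_ <;> ring

end DirectSumState

/-- solution integration: given two perfect strategies of the same `m × n`
game and weights `β₁, β₂ > 0` with `β₁² + β₂² = 1`, the block-diagonal observables together
with the embedded state `β₁ ψ¹ ⊕ β₂ ψ²` form a perfect strategy. -/
theorem perfectStrategy_integration
    {m n dA1 dB1 dA2 dB2 : ℕ}
    (A1 : Fin m → Fin n → Matrix (Fin dA1) (Fin dA1) ℂ)
    (B1 : Fin m → Fin n → Matrix (Fin dB1) (Fin dB1) ℂ)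
    (ψ1 : Fin dA1 × Fin dB1 → ℂ)
    (h1 : IsPerfectStrategy A1 B1 ψ1)
    (A2 : Fin m → Fin n → Matrix (Fin dA2) (Fin dA2) ℂ)
    (B2 : Fin m → Fin n → Matrix (Fin dB2) (Fin dB2) ℂ)
    (ψ2 : Fin dA2 × Fin dB2 → ℂ)
    (h2 : IsPerfectStrategy A2 B2 ψ2)
    (β1 β2 : ℝ) (hβ1 : 0 < β1) (hβ2 : 0 < β2) (hβ : β1 ^ 2 + β2 ^ 2 = 1) :
    IsPerfectStrategy
      (fun i j => Matrix.fromBlocks (A1 i j) 0 0 (A2 i j))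
      (fun i j => Matrix.fromBlocks (B1 i j) 0 0 (B2 i j))
      (fun pq : (Fin dA1 ⊕ Fin dA2) × (Fin dB1 ⊕ Fin dB2) =>
        match pq with
        | (Sum.inl p, Sum.inl q) => (β1 : ℂ) * ψ1 (p, q)
        | (Sum.inr p, Sum.inr q) => (β2 : ℂ) * ψ2 (p, q)
        | _ => 0) := by
  obtain ⟨hA1, sA1, cA1, pA1, hB1, sB1, cB1, pB1, n1, e1⟩ := h1
  obtain ⟨hA2, sA2, cA2, pA2, hB2, sB2, cB2, pB2, n2, e2⟩ := h2
  have hβ' : (β1 : ℂ) ^ 2 + (β2 : ℂ) ^ 2 = 1 := mod_cast hβ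
  suffices h : IsPerfectStrategy (fun i j => Matrix.fromBlocks (A1 i j) 0 0 (A2 i j))
      (fun i j => Matrix.fromBlocks (B1 i j) 0 0 (B2 i j)) (directSumState β1 β2 ψ1 ψ2) by
    convert h using 1
    ext ⟨p | p, q | q⟩ <;> rfl
  refine ⟨fun i j => ?_, fun i j => ?_, fun i j j' => ?_, fun i => ?_,
    fun i j => ?_, fun i j => ?_, fun i i' j => ?_, fun j => ?_, ?_, fun i j => ?_⟩
  · exact (hA1 i j).fromBlocks (by simp) (hA2 i j)
  · simp [Matrix.fromBlocks_multiply, sA1, sA2]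
  · simp [Matrix.fromBlocks_multiply, cA1 i j j', cA2 i j j']
  · simp [prod_ofFn_fromBlocks_diagonal, pA1, pA2]
  · exact (hB1 i j).fromBlocks (by simp) (hB2 i j)
  · simp [Matrix.fromBlocks_multiply, sB1, sB2]
  · simp [Matrix.fromBlocks_multiply, cB1 i i' j, cB2 i i' j]
  · rw [prod_ofFn_fromBlocks_diagonal, pB1, pB2, ← Matrix.fromBlocks_one, Matrix.fromBlocks_neg,
      neg_zero, neg_zero]
  · rw [star_directSumState_dotProduct, n1, n2, mul_one, mul_one, hβ']
  · rw [kronecker_fromBlocks_mulVec_directSumState, star_directSumState_dotProduct, e1, e2,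
      mul_one, mul_one, hβ']
end
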